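/- An edge ideal I(G) satisfies I(G)^{(r)} = I(G)^r for all r (i.e., is normally torsion free) if and only if G is a bipartite graph. -/

import Mathlib

open MvPolynomial

/-- The complement of the union of the minimal primes of `I`, as a submonoid. -/
def symbCompl {R : Type*} [CommRing R] (I : Ideal R) : Submonoid R where
  carrier := {s | ∀ p ∈ I.minimalPrimes, s ∉ p}
  one_mem' := by
    intro p hp h1
    exact hp.1.1.ne_top ((Ideal.eq_top_iff_one p).mpr h1)
  mul_mem' := by
    intro a b ha hb p hp hab
    rcases hp.1.1.mem_or_mem hab with h | h
    · exact ha p hp h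
    · exact hb p hp h

/-- The `r`-th symbolic power of `I`. -/
noncomputable def symbolicPower {R : Type*} [CommRing R] (I : Ideal R) (r : ℕ) : Ideal R :=
  Ideal.comap (algebraMap R (Localization (symbCompl I)))
    (Ideal.map (algebraMap R (Localization (symbCompl I))) (I ^ r))

/-- The edge ideal of a simple graph. -/
noncomputable def graphEdgeIdeal (K : Type*) [Field K] {n : ℕ} (G : SimpleGraph (Fin n)) :
    Ideal (MvPolynomial (Fin n) K) :=
  Ideal.span {m | ∃ i j : Fin n, G.Adj i j ∧ m = X i * X j}

def IsCov {n : ℕ} (G : SimpleGraph (Fin n)) (C : Finset (Fin n)) : Prop :=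
  ∀ i j, G.Adj i j → i ∈ C ∨ j ∈ C

set_option maxHeartbeats 1000000 in
lemma step_edge {n : ℕ} (G : SimpleGraph (Fin n)) (col : Fin n → Bool)
    (hcol : ∀ i j, G.Adj i j → col i ≠ col j) (a : Fin n →₀ ℕ) (r : ℕ)
    (h : ∀ C, IsCov G C → r + 1 ≤ ∑ i ∈ C, a i) :
    ∃ i j, G.Adj i j ∧ 1 ≤ a i ∧ 1 ≤ a j ∧
      ∀ C, IsCov G C → i ∈ C → j ∈ C → r + 2 ≤ ∑ k ∈ C, a k := by
  classical
  by_cases ht : ∃ C, IsCov G C ∧ ∑ k ∈ C, a k = r + 1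
  · obtain ⟨D, hD, hDr⟩ := ht
    obtain ⟨i, hiD, hi⟩ : ∃ i ∈ D, a i ≠ 0 := by
      by_contra! hc
      rw [Finset.sum_eq_zero hc] at hDr
      omega
    -- optimal tight cover containing i
    let S : Finset (Finset (Fin n)) :=
      Finset.univ.filter fun C => IsCov G C ∧ ∑ k ∈ C, a k = r + 1 ∧ i ∈ C
    let mu : Finset (Fin n) → ℕ := fun C =>
      (Finset.univ.filter fun k => (col k = col i ∧ k ∈ C) ∨ (col k ≠ col i ∧ k ∉ C)).card
    obtain ⟨C, hCS, hmin⟩ := Finset.exists_min_image S mu ⟨D, by simp [S, hD, hDr, hiD]⟩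
    simp only [S, Finset.mem_filter, Finset.mem_univ, true_and] at hCS hmin
    obtain ⟨hC, hCr, hiC⟩ := hCS
    obtain ⟨j, hij, hjC, hj⟩ : ∃ j, G.Adj i j ∧ j ∉ C ∧ a j ≠ 0 := by
      by_contra! hc
      let C' := (C.erase i) ∪ Finset.univ.filter fun k => a k = 0
      have hcov : IsCov G C' := by
        have key : ∀ k l, G.Adj k l → k ∈ C → k ∈ C' ∨ l ∈ C' := by
          intro k l hkl hk
          by_cases hki : k = i
          · subst hki
            right
            by_cases hl : l ∈ C
            · simp [C', hl, hkl.ne.symm]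
            · simp [C', hc l hkl hl]
          · left; simp [C', hki, hk]
        intro k l hkl
        rcases hC k l hkl with hk | hk
        · exact key k l hkl hk
        · exact (key l k hkl.symm hk).symm
      have h1 := h C' hcov
      have h2 : ∑ k ∈ C', a k = ∑ k ∈ C.erase i, a k := by
        symm
        apply Finset.sum_subset Finset.subset_union_left
        intro x hx hx'
        simp only [C', Finset.mem_union, hx', false_or, Finset.mem_filter] at hx
        exact hx.2
      have h3 := Finset.add_sum_erase C a hiC
      omega
    refine ⟨i, j, hij, by omega, by omega, ?_⟩
    intro C' hC' hiC' hjC'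
    by_contra hlt
    have hC'r : ∑ k ∈ C', a k = r + 1 := by have := h C' hC'; omega
    let M := Finset.univ.filter fun k =>
      (col k = col i ∧ k ∈ C ∧ k ∈ C') ∨ (col k ≠ col i ∧ (k ∈ C ∨ k ∈ C'))
    let N := Finset.univ.filter fun k =>
      (col k ≠ col i ∧ k ∈ C ∧ k ∈ C') ∨ (col k = col i ∧ (k ∈ C ∨ k ∈ C'))
    have hM : IsCov G M := by
      intro k l hkl
      have h1 := hC k l hkl
      have h2 := hC' k l hkl
      have h3 := hcol k l hkl
      have h4 : col k = col i ∨ col l = col i := by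
        revert h3; cases col k <;> cases col l <;> cases col i <;> simp
      simp only [M, Finset.mem_filter, Finset.mem_univ, true_and]
      by_cases h5 : col k = col i
      · have : col l ≠ col i := fun h => h3 (h5.trans h.symm)
        tauto
      · tauto
    have hN : IsCov G N := by
      intro k l hkl
      have h1 := hC k l hkl
      have h2 := hC' k l hkl
      have h3 := hcol k l hkl
      have h4 : col k = col i ∨ col l = col i := by
        revert h3; cases col k <;> cases col l <;> cases col i <;> simp
      simp only [N, Finset.mem_filter, Finset.mem_univ, true_and]
      by_cases h5 : col k = col i
      · have : col l ≠ col i := fun h => h3 (h5.trans h.symm)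
        tauto
      · tauto
    have hsum : ∑ k ∈ M, a k + ∑ k ∈ N, a k = ∑ k ∈ C, a k + ∑ k ∈ C', a k := by
      have e : ∀ T : Finset (Fin n), ∑ k ∈ T, a k = ∑ k, if k ∈ T then a k else 0 := by
        intro T; rw [Finset.sum_ite_mem, Finset.univ_inter]
      rw [e M, e N, e C, e C', ← Finset.sum_add_distrib, ← Finset.sum_add_distrib]
      apply Finset.sum_congr rfl
      intro k _
      simp only [M, N, Finset.mem_filter, Finset.mem_univ, true_and]
      by_cases h1 : col k = col i <;> by_cases h2 : k ∈ C <;> by_cases h3 : k ∈ C' <;>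
        simp [h1, h2, h3]
    have hMr : ∑ k ∈ M, a k = r + 1 := by
      have := h M hM
      have := h N hN
      omega
    have hmu := hmin M ⟨hM, hMr, by simp [M, hiC, hiC']⟩
    have hji : col j ≠ col i := (hcol i j hij).symm
    refine absurd hmu (not_le.mpr ?_)
    apply Finset.card_lt_card
    rw [Finset.ssubset_iff_of_subset]
    · refine ⟨j, by simp [hji, hjC], by simp [hji, M, hjC']⟩
    · intro k
      simp only [M, Finset.mem_filter, Finset.mem_univ, true_and]
      tauto
  · push Not at ht
    obtain ⟨i, j, hij, hi, hj⟩ : ∃ i j, G.Adj i j ∧ a i ≠ 0 ∧ a j ≠ 0 := by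
      by_contra! hc
      have := h (Finset.univ.filter fun k => a k = 0) (by
        intro k l hkl
        have := hc k l hkl
        simp only [Finset.mem_filter, Finset.mem_univ, true_and]
        tauto)
      rw [Finset.sum_eq_zero (by simp)] at this
      omega
    refine ⟨i, j, hij, by omega, by omega, fun C hC _ _ => ?_⟩
    have := h C hC
    have := ht C hC
    omega

lemma monomial_mem {K : Type*} [Field K] {n : ℕ} (G : SimpleGraph (Fin n)) (col : Fin n → Bool)
    (hcol : ∀ i j, G.Adj i j → col i ≠ col j) (r : ℕ) : ∀ (a : Fin n →₀ ℕ),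
    (∀ C, IsCov G C → r ≤ ∑ i ∈ C, a i) →
    (monomial a (1 : K)) ∈ graphEdgeIdeal K G ^ r := by
  classical
  induction r with
  | zero => intro a _; simp
  | succ r ih =>
    intro a h
    obtain ⟨i, j, hij, hi, hj, H⟩ := step_edge G col hcol a r h
    have hne : i ≠ j := hij.ne
    obtain ⟨b, rfl⟩ : ∃ b, a = b + (Finsupp.single i 1 + Finsupp.single j 1) := by
      refine ⟨a - (Finsupp.single i 1 + Finsupp.single j 1), ?_⟩
      ext k
      simp only [Finsupp.add_apply, Finsupp.tsub_apply, Finsupp.single_apply]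
      by_cases h1 : i = k
      · subst h1; simp [hne.symm]; omega
      · by_cases h2 : j = k
        · subst h2; simp [h1]; omega
        · simp [h1, h2]
    have hs : ∀ C : Finset (Fin n), ∑ k ∈ C, (b + (Finsupp.single i 1 + Finsupp.single j 1) : Fin n →₀ ℕ) k
        = ∑ k ∈ C, b k + ((if i ∈ C then 1 else 0) + (if j ∈ C then 1 else 0)) := by
      intro C
      simp [Finset.sum_add_distrib, Finsupp.single_apply]
    have hb := ih b (by
      intro C hC
      have h1 := h C hC
      have h2 := H C hC
      rw [hs] at h1 h2
      split_ifs at h1 h2 <;> simp_all <;> omega)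
    have : monomial (b + (Finsupp.single i 1 + Finsupp.single j 1)) (1 : K)
        = monomial b 1 * (X i * X j) := by
      simp [X, monomial_mul]
    rw [this, pow_succ]
    exact Ideal.mul_mem_mul hb (Ideal.subset_span ⟨i, j, hij, rfl⟩)

noncomputable def phi (K : Type*) [Field K] {n : ℕ} (C : Finset (Fin n)) :
    MvPolynomial (Fin n) K →ₐ[K] Polynomial (MvPolynomial (Fin n) K) :=
  aeval fun i => Polynomial.C (X i) * Polynomial.X ^ (if i ∈ C then 1 else 0)

lemma phi_monomial {K : Type*} [Field K] {n : ℕ} (C : Finset (Fin n)) (u : Fin n →₀ ℕ) (c : K) :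
    phi K C (monomial u c) = Polynomial.C (monomial u c) * Polynomial.X ^ (∑ i ∈ C, u i) := by
  classical
  rw [phi, aeval_monomial, Finsupp.prod_fintype _ _ (by simp)]
  simp_rw [mul_pow, ← pow_mul]
  rw [Finset.prod_mul_distrib, Finset.prod_pow_eq_pow_sum, ← mul_assoc]
  congr 1
  · rw [monomial_eq, Finsupp.prod_fintype _ _ (by simp)]
    simp only [map_mul, map_prod, map_pow]
    rfl
  · congr 1
    simp

lemma phi_coeff {K : Type*} [Field K] {n : ℕ} (C : Finset (Fin n)) (f : MvPolynomial (Fin n) K)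
    (k : ℕ) (a : Fin n →₀ ℕ) :
    coeff a ((phi K C f).coeff k) = if ∑ i ∈ C, a i = k then coeff a f else 0 := by
  classical
  induction f using MvPolynomial.induction_on' with
  | monomial u c =>
    rw [phi_monomial, Polynomial.coeff_C_mul_X_pow]
    by_cases h : u = a
    · subst h
      by_cases hk : k = ∑ i ∈ C, u i
      · simp [hk]
      · simp [hk, Ne.symm hk]
    · split_ifs <;> simp [coeff_monomial, h]
  | add p q hp hq =>
    rw [map_add, Polynomial.coeff_add, coeff_add, hp, hq]
    split_ifs <;> simp

lemma phi_dvd {K : Type*} [Field K] {n : ℕ} (C : Finset (Fin n)) (f : MvPolynomial (Fin n) K)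
    (r : ℕ) (h : Polynomial.X ^ r ∣ phi K C f) (a : Fin n →₀ ℕ) (ha : a ∈ f.support) :
    r ≤ ∑ i ∈ C, a i := by
  by_contra hlt
  have h1 := Polynomial.X_pow_dvd_iff.mp h (∑ i ∈ C, a i) (by omega)
  have h2 := phi_coeff C f (∑ i ∈ C, a i) a
  rw [h1] at h2
  simp at h2
  exact (mem_support_iff.mp ha) h2.symm

/-- the prime of a cover -/
noncomputable def PP (K : Type*) [Field K] {n : ℕ} (C : Finset (Fin n)) :
    Ideal (MvPolynomial (Fin n) K) :=
  Ideal.comap (phi K C) (Ideal.span {Polynomial.X})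

lemma mem_PP {K : Type*} [Field K] {n : ℕ} (C : Finset (Fin n)) (f : MvPolynomial (Fin n) K) :
    f ∈ PP K C ↔ Polynomial.X ∣ phi K C f := by
  rw [PP, Ideal.mem_comap, Ideal.mem_span_singleton]

lemma PP_prime {K : Type*} [Field K] {n : ℕ} (C : Finset (Fin n)) : (PP K C).IsPrime := by
  have : (Ideal.span {(Polynomial.X : Polynomial (MvPolynomial (Fin n) K))}).IsPrime :=
    (Ideal.span_singleton_prime Polynomial.X_ne_zero).mpr Polynomial.prime_X
  exact Ideal.comap_isPrime _ _

lemma X_mem_PP {K : Type*} [Field K] {n : ℕ} (C : Finset (Fin n)) (i : Fin n) :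
    (X i : MvPolynomial (Fin n) K) ∈ PP K C ↔ i ∈ C := by
  rw [mem_PP]
  constructor
  · intro h
    have := phi_dvd C (X i) 1 (by simpa using h) (Finsupp.single i 1) (by simp)
    by_contra hi
    rw [Finset.sum_eq_zero] at this
    · omega
    · intro x hx
      rw [Finsupp.single_apply, if_neg]
      rintro rfl
      exact hi hx
  · intro h
    simp [phi, h]

lemma PP_le {K : Type*} [Field K] {n : ℕ} (C : Finset (Fin n)) (Q : Ideal (MvPolynomial (Fin n) K))
    (h : ∀ i ∈ C, X i ∈ Q) : PP K C ≤ Q := by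
  intro f hf
  have h1 : f ∈ Ideal.span (X '' (C : Set (Fin n)) : Set (MvPolynomial (Fin n) K)) := by
    rw [mem_ideal_span_X_image]
    intro m hm
    have := phi_dvd C f 1 (by simpa using (mem_PP C f).mp hf) m hm
    by_contra! hc
    rw [Finset.sum_eq_zero (by simpa using hc)] at this
    omega
  refine Ideal.span_le.mpr ?_ h1
  rintro _ ⟨i, hi, rfl⟩
  exact h i hi

lemma edge_le_PP {K : Type*} [Field K] {n : ℕ} (G : SimpleGraph (Fin n)) (C : Finset (Fin n))
    (hC : IsCov G C) : graphEdgeIdeal K G ≤ PP K C := by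
  refine Ideal.span_le.mpr ?_
  rintro _ ⟨i, j, hij, rfl⟩
  rcases hC i j hij with h | h
  · exact Ideal.mul_mem_right _ _ ((X_mem_PP C i).mpr h)
  · exact Ideal.mul_mem_left _ _ ((X_mem_PP C j).mpr h)

lemma cov_of_prime {K : Type*} [Field K] {n : ℕ} (G : SimpleGraph (Fin n))
    (Q : Ideal (MvPolynomial (Fin n) K)) (hQ : Q.IsPrime) (hI : graphEdgeIdeal K G ≤ Q)
    (D : Finset (Fin n)) (hD : ∀ i, X i ∈ Q → i ∈ D) : IsCov G D := by
  intro i j hij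
  have : (X i * X j : MvPolynomial (Fin n) K) ∈ Q := hI (Ideal.subset_span ⟨i, j, hij, rfl⟩)
  exact (hQ.mem_or_mem this).imp (hD i) (hD j)

lemma PP_min {K : Type*} [Field K] {n : ℕ} (G : SimpleGraph (Fin n)) (C : Finset (Fin n))
    (hC : Minimal (IsCov G) C) : PP K C ∈ (graphEdgeIdeal K G).minimalPrimes := by
  classical
  refine ⟨⟨PP_prime C, edge_le_PP G C hC.1⟩, ?_⟩
  rintro Q ⟨hQ, hI⟩ hle
  have hD := cov_of_prime G Q hQ hI (Finset.univ.filter fun i => X i ∈ Q) (by simp)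
  have := hC.2 hD (by
    intro i hi
    simp at hi
    exact (X_mem_PP C i).mp (hle hi))
  apply PP_le
  intro i hi
  simpa using this hi

lemma mem_symb {R : Type*} [CommRing R] (I : Ideal R) (r : ℕ) (f : R) :
    f ∈ symbolicPower I r ↔ ∃ s ∈ symbCompl I, s * f ∈ I ^ r := by
  rw [symbolicPower, Ideal.mem_comap, IsLocalization.algebraMap_mem_map_algebraMap_iff (symbCompl I)]

lemma phi_edge_pow {K : Type*} [Field K] {n : ℕ} (G : SimpleGraph (Fin n)) (C : Finset (Fin n))
    (hC : IsCov G C) (r : ℕ) (f : MvPolynomial (Fin n) K) (hf : f ∈ graphEdgeIdeal K G ^ r) :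
    Polynomial.X ^ r ∣ phi K C f := by
  rw [← Ideal.mem_span_singleton, ← Ideal.span_singleton_pow]
  have h1 : (graphEdgeIdeal K G).map (phi K C) ≤ Ideal.span {Polynomial.X} :=
    Ideal.map_le_iff_le_comap.mpr (edge_le_PP G C hC)
  apply Ideal.pow_right_mono h1 r
  rw [← Ideal.map_pow]
  exact Ideal.mem_map_of_mem _ hf

lemma backward {K : Type*} [Field K] {n : ℕ} (G : SimpleGraph (Fin n)) (hG : G.Colorable 2)
    (r : ℕ) : symbolicPower (graphEdgeIdeal K G) r = graphEdgeIdeal K G ^ r := by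
  classical
  obtain ⟨c⟩ := hG
  apply le_antisymm _ Ideal.le_comap_map
  intro f hf
  obtain ⟨s, hs, hsf⟩ := (mem_symb _ _ _).mp hf
  rw [f.as_sum]
  refine Ideal.sum_mem _ fun a ha => ?_
  have : monomial a (coeff a f) = MvPolynomial.C (coeff a f) * monomial a 1 := by
    simp [C_mul_monomial]
  rw [this]
  refine Ideal.mul_mem_left _ _ (monomial_mem G (fun i => c i = 0) ?_ r a ?_)
  · intro i j hij h
    have h2 := c.valid hij
    simp only [decide_eq_decide] at h
    generalize c i = x at *
    generalize c j = y at *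
    omega
  · intro D hD
    obtain ⟨C, hCD, hC⟩ := exists_minimal_le_of_wellFoundedLT (IsCov G) D hD
    refine le_trans ?_ (Finset.sum_le_sum_of_subset hCD)
    refine phi_dvd C f r ?_ a ha
    have h1 := phi_edge_pow G C hC.1 r _ hsf
    rw [map_mul] at h1
    refine Polynomial.prime_X.pow_dvd_of_dvd_mul_left r ?_ h1
    rw [← mem_PP]
    exact hs _ (PP_min G C hC)

lemma min_nbr {K : Type*} [Field K] {n : ℕ} (G : SimpleGraph (Fin n))
    (P : Ideal (MvPolynomial (Fin n) K)) (hP : P ∈ (graphEdgeIdeal K G).minimalPrimes)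
    (i : Fin n) (hi : X i ∈ P) : ∃ j, G.Adj i j ∧ X j ∉ P := by
  classical
  by_contra! hc
  have hcov : IsCov G (Finset.univ.filter fun k => X k ∈ P ∧ k ≠ i) := by
    have hc' := cov_of_prime G P hP.1.1 hP.1.2 (Finset.univ.filter fun i => X i ∈ P) (by simp)
    intro k l hkl
    have h1 := hc' k l hkl
    simp only [Finset.mem_filter, Finset.mem_univ, true_and] at h1 ⊢
    have h2 := hkl.ne
    by_cases hk : k = i
    · subst hk; exact Or.inr ⟨hc l hkl, h2.symm⟩
    · by_cases hl : l = i
      · subst hl; exact Or.inl ⟨hc k hkl.symm, h2⟩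
      · tauto
  have h1 := hP.2 ⟨PP_prime _, edge_le_PP G _ hcov⟩ (PP_le _ _ (by simp +contextual))
  have h2 := (X_mem_PP _ i).mp (h1 hi)
  simp at h2

lemma list_mem {K : Type*} [Field K] {n : ℕ} (G : SimpleGraph (Fin n))
    (P : Ideal (MvPolynomial (Fin n) K)) (hP : P ∈ (graphEdgeIdeal K G).minimalPrimes)
    (C : Finset (Fin n)) (hC : ∀ i ∈ C, X i ∈ P) (l : List (Fin n)) :
    ∃ s, s ∉ P ∧ s * (l.map X).prod ∈ graphEdgeIdeal K G ^ (l.countP (· ∈ C)) := by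
  have hp := hP.1.1
  induction l with
  | nil => exact ⟨1, fun h => hp.ne_top ((Ideal.eq_top_iff_one P).mpr h), by simp⟩
  | cons i l ih =>
    obtain ⟨s, hs, hm⟩ := ih
    by_cases hi : i ∈ C
    · obtain ⟨j, hij, hj⟩ := min_nbr G P hP i (hC i hi)
      refine ⟨s * X j, fun h => (hp.mem_or_mem h).elim hs hj, ?_⟩
      rw [List.countP_cons_of_pos (by simpa using hi), pow_succ, List.map_cons, List.prod_cons]
      have : s * X j * (X i * (l.map X).prod) = (s * (l.map X).prod) * (X i * X j) := by ring
      rw [this]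
      exact Ideal.mul_mem_mul hm (Ideal.subset_span ⟨i, j, hij, rfl⟩)
    · refine ⟨s, hs, ?_⟩
      rw [List.countP_cons_of_neg (by simpa using hi), List.map_cons, List.prod_cons]
      have : s * (X i * (l.map X).prod) = X i * (s * (l.map X).prod) := by ring
      rw [this]
      exact Ideal.mul_mem_left _ _ hm

lemma walk_count {n : ℕ} (G : SimpleGraph (Fin n)) (C : Finset (Fin n)) (hC : IsCov G C)
    {u v : Fin n} (w : G.Walk u v) :
    w.length + (if v ∈ C then 1 else 0) ≤
      2 * w.support.tail.countP (· ∈ C) + (if u ∈ C then 1 else 0) := by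
  induction w with
  | nil => simp
  | @cons u x v hux p ih =>
    have h1 := hC u x hux
    have h2 : p.support = x :: p.support.tail := p.cons_tail_support.symm
    rw [SimpleGraph.Walk.support_cons, List.tail_cons]
    nth_rewrite 1 [h2]
    rw [List.countP_cons,
      SimpleGraph.Walk.length_cons]
    by_cases hu : u ∈ C <;> by_cases hx : x ∈ C <;>
      simp only [hu, hx, if_true, if_false, decide_true, decide_false, or_self, Bool.false_eq_true] at h1 ih ⊢ <;> omega

lemma edge_deg {K : Type*} [Field K] {n : ℕ} (G : SimpleGraph (Fin n)) (r : ℕ)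
    (f : MvPolynomial (Fin n) K) (hf : f ∈ graphEdgeIdeal K G ^ r) :
    (Polynomial.X : Polynomial K) ^ (2 * r) ∣ aeval (fun _ => Polynomial.X) f := by
  rw [pow_mul, ← Ideal.mem_span_singleton, ← Ideal.span_singleton_pow]
  have h1 : (graphEdgeIdeal K G).map (aeval (fun _ => (Polynomial.X : Polynomial K)))
      ≤ Ideal.span {Polynomial.X ^ 2} := by
    rw [Ideal.map_le_iff_le_comap]
    refine Ideal.span_le.mpr ?_
    rintro _ ⟨i, j, hij, rfl⟩
    simp [Ideal.mem_comap, Ideal.mem_span_singleton, ← pow_two]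
  apply Ideal.pow_right_mono h1 r
  rw [← Ideal.map_pow]
  exact Ideal.mem_map_of_mem _ hf

lemma forward {K : Type*} [Field K] {n : ℕ} (G : SimpleGraph (Fin n))
    (h : ∀ r : ℕ, 1 ≤ r → symbolicPower (graphEdgeIdeal K G) r = graphEdgeIdeal K G ^ r) :
    G.Colorable 2 := by
  classical
  rw [SimpleGraph.two_colorable_iff_forall_loop_even]
  intro u w
  by_contra hodd
  rw [Nat.not_even_iff_odd] at hodd
  obtain ⟨k, hk⟩ := hodd
  let m : MvPolynomial (Fin n) K := (w.support.tail.map X).prod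
  have hm : m ∉ graphEdgeIdeal K G ^ (k + 1) := by
    intro hm
    have h1 := edge_deg G _ _ hm
    have h2 : aeval (fun _ => (Polynomial.X : Polynomial K)) m = Polynomial.X ^ w.length := by
      simp [m, map_list_prod, Function.comp_def]
    rw [h2, pow_dvd_pow_iff Polynomial.X_ne_zero Polynomial.not_isUnit_X] at h1
    omega
  rw [← h (k + 1) (by omega), mem_symb] at hm
  apply hm
  let J : Ideal (MvPolynomial (Fin n) K) :=
    Submodule.comap (LinearMap.mulRight (MvPolynomial (Fin n) K) m) (graphEdgeIdeal K G ^ (k + 1))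
  have hJ : ∀ s, s ∈ J ↔ s * m ∈ graphEdgeIdeal K G ^ (k + 1) := fun s => Iff.rfl
  by_contra! hc
  have hsub : (J : Set (MvPolynomial (Fin n) K)) ⊆
      ⋃ P ∈ (graphEdgeIdeal K G).minimalPrimes, (P : Set (MvPolynomial (Fin n) K)) := by
    intro s hs
    by_contra hs'
    simp only [Set.mem_iUnion, not_exists] at hs'
    exact hc s (fun p hp => hs' p hp) ((hJ s).mp hs)
  obtain ⟨P, hP, hJP⟩ := (Ideal.subset_union_prime_finite
    (Ideal.finite_minimalPrimes_of_isNoetherianRing _ (graphEdgeIdeal K G))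
    (f := fun P => P) ⊥ ⊥ (fun P hP _ _ => hP.1.1)).mp hsub
  obtain ⟨s, hs, hsm⟩ := list_mem G P hP (Finset.univ.filter fun i => X i ∈ P) (by simp)
    w.support.tail
  have hcnt := walk_count G _ (cov_of_prime G P hP.1.1 hP.1.2
    (Finset.univ.filter fun i => X i ∈ P) (by simp)) w
  exact hs (hJP ((hJ s).mpr (Ideal.pow_le_pow_right (by omega) hsm)))

theorem normally_torsion_free_iff_bipartite {K : Type*} [Field K] {n : ℕ}
    (G : SimpleGraph (Fin n)) :
    (∀ r : ℕ, 1 ≤ r → symbolicPower (graphEdgeIdeal K G) r = graphEdgeIdeal K G ^ r) ↔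
      G.Colorable 2 :=
  ⟨forward G, fun h r _ => backward G h r⟩
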